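/- For every 2 ≤ k ≤ n and every 0 ≤ l ≤ k−2, the coefficient b_l^k is strictly positive. -/

import Mathlib

open Real MeasureTheory Finset

/-- Time step `Δt = T / n`. -/
noncomputable def dt (T : ℝ) (n : ℕ) : ℝ := T / n

/-- Time grid point `t_k = k Δt`. -/
noncomputable def tk (T : ℝ) (n k : ℕ) : ℝ := k * dt T n

/-- Quadrature exponent `λ_i = e^{i h}`. -/
noncomputable def lamESA (h : ℝ) (i : ℤ) : ℝ := Real.exp ((i : ℝ) * h)

/-- Quadrature weight `θ_{a,i} = h e^{a i h} / Γ(a)`. -/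
noncomputable def thESA (a h : ℝ) (i : ℤ) : ℝ := h * Real.exp (a * (i : ℝ) * h) / Real.Gamma a

/-- Piecewise-constant interpolation `Π₁u'` of the derivative:
`Π₁u'(τ) = (u(t_l) - u(t_{l-1}))/Δt` for `τ ∈ (t_{l-1}, t_l]`. -/
noncomputable def Pi1 (T : ℝ) (n : ℕ) (u : ℝ → ℝ) (τ : ℝ) : ℝ :=
  (u (tk T n ⌈τ / dt T n⌉₊) - u (tk T n (⌈τ / dt T n⌉₊ - 1))) / dt T n

/-- The ESA hypothesis with tolerance `ε`:
`|s^{-a} - Σ_{i=Nlo+1}^{Nhi} θ_{a,i} e^{-λ_i s}| ≤ ε s^{-a}` for all `s ∈ [Dt/T, 1]`. -/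
def ESAhyp (a Dt T ε h : ℝ) (Nlo Nhi : ℤ) : Prop :=
  ∀ s ∈ Set.Icc (Dt / T) 1,
    |s ^ (-a) - ∑ i ∈ Finset.Icc (Nlo + 1) Nhi, thESA a h i * Real.exp (-(lamESA h i) * s)|
      ≤ ε * s ^ (-a)

/-- `Ib k j = Σ_i θ_{a,i} ∫_{t_{j-1}}^{t_j} e^{-λ_i (t_k - τ)/T} dτ`. -/
noncomputable def Ib (T : ℝ) (n : ℕ) (a h : ℝ) (Nlo Nhi : ℤ) (k j : ℕ) : ℝ :=
  ∑ i ∈ Finset.Icc (Nlo + 1) Nhi,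
    thESA a h i * ∫ τ in (tk T n (j-1))..(tk T n j), Real.exp (-(lamESA h i) * (tk T n k - τ) / T)

/-- The coefficients `b_l^k` of the fast ESA scheme (with `a` the order at level `k`):
`b_0^1 = 1`; for `k ≥ 2`, `b_0^k = T^{-a} Δt^{a-1}(1-a) Ib k 1`,
`b_{k-1}^k = 1 - T^{-a} Δt^{a-1}(1-a) Ib k (k-1)`, and
`b_l^k = T^{-a} Δt^{a-1}(1-a) (Ib k (l+1) - Ib k l)` for `1 ≤ l ≤ k-2`. -/
noncomputable def bcoef (T : ℝ) (n : ℕ) (a h : ℝ) (Nlo Nhi : ℤ) (k l : ℕ) : ℝ :=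
  if k = 1 then 1
  else if l = 0 then T ^ (-a) * (dt T n) ^ (a - 1) * (1 - a) * Ib T n a h Nlo Nhi k 1
  else if l = k - 1 then
    1 - T ^ (-a) * (dt T n) ^ (a - 1) * (1 - a) * Ib T n a h Nlo Nhi k (k-1)
  else T ^ (-a) * (dt T n) ^ (a - 1) * (1 - a) *
    (Ib T n a h Nlo Nhi k (l+1) - Ib T n a h Nlo Nhi k l)

lemma dt_pos {T : ℝ} (hT : 0 < T) {n : ℕ} (hn : 0 < n) : 0 < dt T n :=
  div_pos hT (Nat.cast_pos.mpr hn)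

lemma tk_succ (T : ℝ) (n j : ℕ) : tk T n (j + 1) = tk T n j + dt T n := by
  simp only [tk]
  push_cast
  ring

lemma tk_mem_Icc {T : ℝ} (hT : 0 ≤ T) {n k : ℕ} (hn : 0 < n) (hkn : k ≤ n) :
    tk T n k ∈ Set.Icc (0 : ℝ) T := by
  have hn' : (0 : ℝ) < n := Nat.cast_pos.mpr hn
  have hkn' : (k : ℝ) ≤ n := Nat.cast_le.mpr hkn
  unfold tk dt
  refine ⟨by positivity, ?_⟩
  rw [← mul_div_assoc, div_le_iff₀ hn', mul_comm]
  gcongr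

lemma thESA_pos {a h : ℝ} (ha : 0 < a) (hh : 0 < h) (i : ℤ) : 0 < thESA a h i :=
  div_pos (mul_pos hh (Real.exp_pos _)) (Real.Gamma_pos_of_pos ha)

/-- The integral of a continuous strictly increasing function grows strictly when the interval
is translated to the right by its own length. -/
lemma integral_lt_integral_add_right_of_strictMono {f : ℝ → ℝ} (hf : StrictMono f)
    (hc : Continuous f) {a d : ℝ} (hd : 0 < d) :
    ∫ x in a..(a + d), f x < ∫ x in (a + d)..(a + d + d), f x := by
  rw [← intervalIntegral.integral_comp_add_right f d]
  have hlt : a < a + d := lt_add_of_pos_right a hd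
  refine intervalIntegral.integral_lt_integral_of_continuousOn_of_le_of_exists_lt hlt
    hc.continuousOn (by fun_prop) (fun x _ => (hf (lt_add_of_pos_right x hd)).le)
    ⟨a, Set.left_mem_Icc.mpr hlt.le, hf hlt⟩

lemma strictMono_exp_kernel {T : ℝ} (hT : 0 < T) (h : ℝ) (i : ℤ) (t : ℝ) :
    StrictMono fun τ : ℝ => Real.exp (-(lamESA h i) * (t - τ) / T) := by
  intro x y hxy
  have hlam : 0 < lamESA h i := Real.exp_pos _
  refine Real.exp_lt_exp.mpr (div_lt_div_of_pos_right ?_ hT)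
  nlinarith

lemma Ib_one_pos {T : ℝ} (hT : 0 < T) {n : ℕ} (hn : 0 < n) {a h : ℝ} (ha : 0 < a) (hh : 0 < h)
    {Nlo Nhi : ℤ} (hN : Nlo < Nhi) (k : ℕ) : 0 < Ib T n a h Nlo Nhi k 1 := by
  refine Finset.sum_pos (fun i _ => mul_pos (thESA_pos ha hh i) ?_)
    (Finset.nonempty_Icc.mpr (Int.add_one_le_iff.mpr hN))
  refine intervalIntegral.intervalIntegral_pos_of_pos
    (Continuous.intervalIntegrable (by fun_prop) _ _) (fun _ => Real.exp_pos _) ?_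
  rw [Nat.sub_self, tk_succ T n 0]
  exact lt_add_of_pos_right _ (dt_pos hT hn)

lemma Ib_lt_Ib_succ {T : ℝ} (hT : 0 < T) {n : ℕ} (hn : 0 < n) {a h : ℝ} (ha : 0 < a)
    (hh : 0 < h) {Nlo Nhi : ℤ} (hN : Nlo < Nhi) (k : ℕ) {l : ℕ} (hl : l ≠ 0) :
    Ib T n a h Nlo Nhi k l < Ib T n a h Nlo Nhi k (l + 1) := by
  obtain ⟨m, rfl⟩ := Nat.exists_eq_succ_of_ne_zero hl
  refine Finset.sum_lt_sum_of_nonempty (Finset.nonempty_Icc.mpr (Int.add_one_le_iff.mpr hN))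
    fun i _ => mul_lt_mul_of_pos_left ?_ (thESA_pos ha hh i)
  simp only [Nat.succ_eq_add_one, Nat.add_sub_cancel, tk_succ T n (m + 1), tk_succ T n m]
  exact integral_lt_integral_add_right_of_strictMono (strictMono_exp_kernel hT h i _)
    (by fun_prop) (dt_pos hT hn)

/-- Lemma 5 i): for 2 ≤ k ≤ n and 0 ≤ l ≤ k−2, b_l^k > 0. -/
theorem bcoef_pos
    (T : ℝ) (hT : 1 ≤ T) (n : ℕ) (hn : 0 < n)
    (alo ahi : ℝ) (halo : 0 < alo) (hlh : alo ≤ ahi) (hahi : ahi < 1)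
    (αf : ℝ → ℝ) (hα : ∀ s ∈ Set.Icc (0:ℝ) T, αf s ∈ Set.Icc alo ahi)
    (h : ℝ) (hh : 0 < h) (Nlo Nhi : ℤ) (hN : Nlo < Nhi)
    (k l : ℕ) (hk2 : 2 ≤ k) (hkn : k ≤ n) (hl : l ≤ k - 2) :
    0 < bcoef T n (αf (tk T n k)) h Nlo Nhi k l := by
  have hT0 : 0 < T := zero_lt_one.trans_le hT
  obtain ⟨hlow, hhigh⟩ := hα _ (tk_mem_Icc hT0.le hn hkn)
  have ha : 0 < αf (tk T n k) := halo.trans_le hlow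
  have hC : 0 < T ^ (-αf (tk T n k)) * (dt T n) ^ (αf (tk T n k) - 1) * (1 - αf (tk T n k)) :=
    mul_pos (mul_pos (Real.rpow_pos_of_pos hT0 _) (Real.rpow_pos_of_pos (dt_pos hT0 hn) _))
      (sub_pos.mpr (hhigh.trans_lt hahi))
  rw [bcoef, if_neg (by omega)]
  split_ifs with h0 h1
  · exact mul_pos hC (Ib_one_pos hT0 hn ha hh hN k)
  · omega
  · exact mul_pos hC (sub_pos.mpr (Ib_lt_Ib_succ hT0 hn ha hh hN k h0))
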